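/- arXiv:1710.08358 — 3 statements merged into one kernel-verified Lean document; each statement's English description precedes it below -/
import Mathlib

section
/- Every tail measure ν with index α > 0 on E^ℤ is σ-finite, and a tail measure is uniquely determined by its restrictions to the sets {x : ‖x_h‖ > 1}, h ∈ ℤ; in particular, if two tail measures ν and ν' with index α agree on every measurable subset of {x : ‖x_h‖ > 1} for every h ∈ ℤ, then ν = ν'. -/
open MeasureTheory
open scoped ENNReal

/-- A measurable cone: a measurable space `E` with a measurable multiplication by positive
scalars, a zero element and a measurable `1`-homogeneous pseudonorm. -/
structure MeasCone (E : Type*) [MeasurableSpace E] where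
  smul : ℝ → E → E
  zero : E
  nrm : E → ℝ
  measurable_smul : Measurable fun p : ℝ × E => smul p.1 p.2
  measurable_nrm : Measurable nrm
  one_smul : ∀ x, smul 1 x = x
  smul_smul : ∀ (u v : ℝ), 0 < u → 0 < v → ∀ x, smul u (smul v x) = smul (u * v) x
  smul_zero' : ∀ (u : ℝ), 0 < u → smul u zero = zero
  nrm_nonneg : ∀ x, 0 ≤ nrm x
  nrm_smul : ∀ (u : ℝ), 0 < u → ∀ x, nrm (smul u x) = u * nrm x
  eq_zero_of_nrm : ∀ x, nrm x = 0 → x = zero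

/-- The `k`-th iterate of the backshift operator: `(B^k x)_h = x_{h-k}`. -/
def seqShift {E : Type*} (k : ℤ) (x : ℤ → E) : ℤ → E := fun h => x (h - k)

/-- Shift invariance of a measure on `E^ℤ`: `ν(BA) = ν(A)` for all measurable `A`. -/
def ShiftInvariant {E : Type*} [MeasurableSpace E] (ν : MeasureTheory.Measure (ℤ → E)) : Prop :=
  ∀ A : Set (ℤ → E), MeasurableSet A → ν (seqShift 1 '' A) = ν A

namespace MeasCone

variable {E : Type*} [MeasurableSpace E] (K : MeasCone E)

/-- The sequence identically equal to the zero element. -/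
def zeroSeq : ℤ → E := fun _ => K.zero

/-- Componentwise scalar multiplication on the sequence space `E^ℤ`. -/
def sSmul (u : ℝ) (x : ℤ → E) : ℤ → E := fun h => K.smul u (x h)


/-- A tail measure with index `α > 0` on `E^ℤ`. -/
def IsTailMeasure (α : ℝ) (ν : Measure (ℤ → E)) : Prop :=
  ν {K.zeroSeq} = 0 ∧
  ν {x | 1 < K.nrm (x 0)} = 1 ∧
  (∀ h : ℤ, ν {x | 1 < K.nrm (x h)} < ⊤) ∧
  ∀ (u : ℝ), 0 < u → ∀ A : Set (ℤ → E), MeasurableSet A →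
    ν (K.sSmul u '' A) = ENNReal.ofReal (u ^ (-α)) * ν A

/-- The spectral map at lag `h`: `x ↦ x / ‖x_h‖`. -/
noncomputable def spectralMap (h : ℤ) (x : ℤ → E) : ℤ → E :=
  fun j => K.smul (K.nrm (x h))⁻¹ (x j)

/-- The law of the local spectral tail process of `ν` at lag `h`:
the pushforward under the spectral map of (the normalization of) the restriction of `ν`
to `{x : ‖x_h‖ > 1}`. -/
noncomputable def spectralLaw (ν : Measure (ℤ → E)) (h : ℤ) : Measure (ℤ → E) :=
  Measure.map (K.spectralMap h)
    ((ν {x | 1 < K.nrm (x h)})⁻¹ • ν.restrict {x | 1 < K.nrm (x h)})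

/-- The time change formula for (the law of) a process `Θ`:
`E[H₀(B^h Θ)] = E[‖Θ_h‖^α H₀(Θ)]` for every measurable `0`-homogeneous
`H₀ : E^ℤ → [0,∞)` vanishing on `{x : ‖x_0‖ = 0}`. -/
def SatisfiesTCF (α : ℝ) (μ : Measure (ℤ → E)) : Prop :=
  ∀ (h : ℤ) (H : (ℤ → E) → ℝ), Measurable H → (∀ x, 0 ≤ H x) →
    (∀ (u : ℝ), 0 < u → ∀ x, H (K.sSmul u x) = H x) →
    (∀ x, K.nrm (x 0) = 0 → H x = 0) →
    ∫⁻ x, ENNReal.ofReal (H (seqShift h x)) ∂μ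
      = ∫⁻ x, ENNReal.ofReal (K.nrm (x h) ^ α) * ENNReal.ofReal (H x) ∂μ

/-- `I(x) = j ∈ ℤ` for the infargmax functional:
`sup_{k ≤ j-1} ‖x_k‖ < ‖x_j‖ = sup_{k ∈ ℤ} ‖x_k‖`. -/
def IsInfArgmax (x : ℤ → E) (j : ℤ) : Prop :=
  (⨆ k : ℤ, ⨆ _ : k < j, ENNReal.ofReal (K.nrm (x k))) < ENNReal.ofReal (K.nrm (x j)) ∧
  ENNReal.ofReal (K.nrm (x j)) = ⨆ k : ℤ, ENNReal.ofReal (K.nrm (x k))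

end MeasCone

namespace MeasCone

variable {E : Type*} [MeasurableSpace E] (K : MeasCone E)

lemma measurable_sSmul (u : ℝ) : Measurable (K.sSmul u : (ℤ → E) → ℤ → E) :=
  measurable_pi_lambda _ fun h =>
    K.measurable_smul.comp (measurable_const.prodMk (measurable_pi_apply h))

lemma sSmul_sSmul_inv {u : ℝ} (hu : 0 < u) (x : ℤ → E) : K.sSmul u (K.sSmul u⁻¹ x) = x := by
  funext h
  simp only [sSmul]
  rw [K.smul_smul u u⁻¹ hu (inv_pos.2 hu), mul_inv_cancel₀ hu.ne', K.one_smul]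

lemma image_sSmul_preimage {u : ℝ} (hu : 0 < u) (A : Set (ℤ → E)) :
    K.sSmul u '' (K.sSmul u ⁻¹' A) = A :=
  Set.image_preimage_eq A fun x => ⟨_, K.sSmul_sSmul_inv hu x⟩

/-- The sequences whose coordinate at `h` has pseudonorm larger than `u`. -/
def exceedance (u : ℝ) (h : ℤ) : Set (ℤ → E) := {x | u < K.nrm (x h)}

lemma measurableSet_exceedance (u : ℝ) (h : ℤ) : MeasurableSet (K.exceedance u h) :=
  measurableSet_lt measurable_const (K.measurable_nrm.comp (measurable_pi_apply h))

lemma preimage_sSmul_exceedance {u : ℝ} (hu : 0 < u) (h : ℤ) :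
    K.sSmul u ⁻¹' K.exceedance u h = {x | 1 < K.nrm (x h)} := by
  ext x
  simp only [exceedance, sSmul, Set.mem_preimage, Set.mem_ofPred_eq, K.nrm_smul u hu]
  exact lt_mul_iff_one_lt_right hu

/-- A countable cover of the sequence space by the zero sequence and exceedance sets. -/
def zeroExceedanceCover : Option (ℤ × ℕ) → Set (ℤ → E)
  | none => {K.zeroSeq}
  | some p => K.exceedance (1 / ((p.2 : ℝ) + 1)) p.1

lemma iUnion_zeroExceedanceCover : ⋃ i, K.zeroExceedanceCover i = Set.univ := by
  refine Set.eq_univ_of_forall fun x => Set.mem_iUnion.2 ?_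
  by_cases hx : ∀ h, K.nrm (x h) = 0
  · exact ⟨none, funext fun h => K.eq_zero_of_nrm _ (hx h)⟩
  · push Not at hx
    obtain ⟨h, hh⟩ := hx
    obtain ⟨n, hn⟩ := exists_nat_one_div_lt ((K.nrm_nonneg (x h)).lt_of_ne' hh)
    exact ⟨some (h, n), hn⟩

namespace IsTailMeasure

variable {K} {α : ℝ} {ν ν' : Measure (ℤ → E)}

lemma measure_eq_mul_preimage_sSmul (hν : K.IsTailMeasure α ν) {u : ℝ} (hu : 0 < u)
    {A : Set (ℤ → E)} (hA : MeasurableSet A) :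
    ν A = ENNReal.ofReal (u ^ (-α)) * ν (K.sSmul u ⁻¹' A) := by
  rw [← hν.2.2.2 u hu _ (K.measurable_sSmul u hA), K.image_sSmul_preimage hu]

lemma measure_exceedance_lt_top (hν : K.IsTailMeasure α ν) {u : ℝ} (hu : 0 < u) (h : ℤ) :
    ν (K.exceedance u h) < ⊤ := by
  rw [hν.measure_eq_mul_preimage_sSmul hu (K.measurableSet_exceedance u h),
    K.preimage_sSmul_exceedance hu]
  exact ENNReal.mul_lt_top ENNReal.ofReal_lt_top (hν.2.2.1 h)

theorem sigmaFinite (hν : K.IsTailMeasure α ν) : SigmaFinite ν := by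
  refine Measure.sigmaFinite_of_countable (S := Set.range K.zeroExceedanceCover)
    (Set.countable_range _) ?_ (by rw [Set.sUnion_range, K.iUnion_zeroExceedanceCover])
  rintro _ ⟨_ | p, rfl⟩
  · exact hν.1.trans_lt ENNReal.zero_lt_top
  · exact hν.measure_exceedance_lt_top Nat.one_div_pos_of_nat p.1

lemma restrict_exceedance_eq (hν : K.IsTailMeasure α ν) (hν' : K.IsTailMeasure α ν')
    {h : ℤ} (hagree : ∀ A : Set (ℤ → E), MeasurableSet A →
      A ⊆ {x | 1 < K.nrm (x h)} → ν A = ν' A) {u : ℝ} (hu : 0 < u) :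
    ν.restrict (K.exceedance u h) = ν'.restrict (K.exceedance u h) := by
  ext A hA
  have hAu := hA.inter (K.measurableSet_exceedance u h)
  rw [Measure.restrict_apply hA, Measure.restrict_apply hA,
    hν.measure_eq_mul_preimage_sSmul hu hAu, hν'.measure_eq_mul_preimage_sSmul hu hAu,
    hagree _ (K.measurable_sSmul u hAu)]
  rw [← K.preimage_sSmul_exceedance hu]
  exact Set.preimage_mono Set.inter_subset_right

theorem eq_of_agree (hν : K.IsTailMeasure α ν) (hν' : K.IsTailMeasure α ν')
    (hagree : ∀ h : ℤ, ∀ A : Set (ℤ → E), MeasurableSet A →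
      A ⊆ {x | 1 < K.nrm (x h)} → ν A = ν' A) : ν = ν' := by
  refine (Measure.ext_iff_of_iUnion_eq_univ K.iUnion_zeroExceedanceCover).2 ?_
  rintro (_ | p)
  · exact (Measure.restrict_eq_zero.2 hν.1).trans (Measure.restrict_eq_zero.2 hν'.1).symm
  · exact hν.restrict_exceedance_eq hν' (hagree p.1) Nat.one_div_pos_of_nat

end IsTailMeasure

end MeasCone

open MeasCone in
/-- every tail measure is σ-finite and is uniquely determined by its
restrictions to the sets `{x : ‖x_h‖ > 1}`, `h ∈ ℤ`. -/
theorem tailMeasure_sigmaFinite_and_eq_of_agree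
    {E : Type*} [MeasurableSpace E] (K : MeasCone E) (α : ℝ) (hα : 0 < α)
    (ν ν' : Measure (ℤ → E))
    (hν : K.IsTailMeasure α ν) (hν' : K.IsTailMeasure α ν')
    (hagree : ∀ h : ℤ, ∀ A : Set (ℤ → E), MeasurableSet A →
      A ⊆ {x | 1 < K.nrm (x h)} → ν A = ν' A) :
    SigmaFinite ν ∧ SigmaFinite ν' ∧ ν = ν' := by
  exact ⟨hν.sigmaFinite, hν'.sigmaFinite, hν.eq_of_agree hν' hagree⟩
end

section
/- Let Z be an E^ℤ-valued process with P(Z = 0) = 0, E[‖Z_0‖^α] = 1, E[‖Z_h‖^α] < ∞ for all h, and let ν(A) = ∫_0^∞ P(rZ ∈ A) α r^{−α−1} dr be the associated tail measure. Then ν is shift-invariant if and only if Z satisfies the tilt-shift formula: E[H(B^h Z)] = E[H(Z)] for every h ∈ ℤ and every measurable α-homogeneous function H : E^ℤ → [0,∞]. -/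
open MeasureTheory
open scoped ENNReal

/-- `∫_0^∞ 1{1 < r^α c} α r^{-α-1} dr = c` for every `c ∈ [0,∞]`. -/
lemma lintegral_Ioi_indicator_one_lt_rpow_mul {α : ℝ} (hα : 0 < α) (c : ℝ≥0∞) :
    ∫⁻ r in Set.Ioi (0 : ℝ), (Set.Ioi (1 : ℝ≥0∞)).indicator 1 (ENNReal.ofReal (r ^ α) * c) *
      ENNReal.ofReal (α * r ^ (-α - 1)) = c := by
  have hreal : ∀ s : ℝ, 0 < s →
      ∫⁻ r in Set.Ioi (0 : ℝ), (Set.Ioi (1 : ℝ≥0∞)).indicator 1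
        (ENNReal.ofReal (r ^ α) * ENNReal.ofReal s) *
        ENNReal.ofReal (α * r ^ (-α - 1)) = ENNReal.ofReal s := by
    intro s hs
    have hb : 0 < s ^ (-α⁻¹) := Real.rpow_pos_of_pos hs _
    have hset : ∀ r : ℝ, 0 < r → (1 < r ^ α * s ↔ s ^ (-α⁻¹) < r) := by
      intro r hr
      rw [← Real.rpow_lt_rpow_iff hb.le hr.le hα, ← Real.rpow_mul hs.le]
      rw [show -α⁻¹ * α = -1 by field_simp, Real.rpow_neg_one, inv_lt_iff_one_lt_mul₀ hs]
    have heq : ∀ r ∈ Set.Ioi (0 : ℝ), (Set.Ioi (1 : ℝ≥0∞)).indicator 1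
        (ENNReal.ofReal (r ^ α) * ENNReal.ofReal s) * ENNReal.ofReal (α * r ^ (-α - 1)) =
        (Set.Ioi (s ^ (-α⁻¹))).indicator (fun r => ENNReal.ofReal (α * r ^ (-α - 1))) r := by
      intro r hr
      have hr : 0 < r := hr
      rw [← ENNReal.ofReal_mul (Real.rpow_nonneg hr.le _)]
      by_cases h : s ^ (-α⁻¹) < r
      · have h' := (hset r hr).2 h
        simp [Set.indicator, h, h']
      · have h' := mt (hset r hr).1 h
        simp [Set.indicator, h, h']
    rw [setLIntegral_congr_fun measurableSet_Ioi heq, lintegral_indicator measurableSet_Ioi,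
      Measure.restrict_restrict measurableSet_Ioi,
      Set.inter_eq_left.2 (Set.Ioi_subset_Ioi hb.le),
      ← ofReal_integral_eq_lintegral_ofReal, integral_const_mul,
      integral_Ioi_rpow_of_lt (by linarith) hb]
    · congr 1
      rw [sub_add_cancel, ← Real.rpow_mul hs.le, show -α⁻¹ * -α = 1 by field_simp, Real.rpow_one]
      field_simp
    · exact (integrableOn_Ioi_rpow_of_lt (by linarith) hb).const_mul α
    · filter_upwards [ae_restrict_mem measurableSet_Ioi] with r hr
      exact mul_nonneg hα.le (Real.rpow_nonneg (hb.trans hr).le _)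
  rcases eq_or_ne c ⊤ with rfl | hc
  · refine ENNReal.eq_top_of_forall_nnreal_le fun s => ?_
    rcases eq_or_ne s 0 with rfl | hs
    · simp
    rw [← ENNReal.ofReal_coe_nnreal, ← hreal s (by positivity)]
    refine lintegral_mono fun r => ?_
    dsimp only
    gcongr
    by_cases h : 1 < ENNReal.ofReal (r ^ α) * ENNReal.ofReal s
    · have h' : 1 < ENNReal.ofReal (r ^ α) * ⊤ := h.trans_le (by gcongr; exact le_top)
      simp only [Set.indicator, Set.mem_Ioi, h, h', if_true, Pi.one_apply, le_refl]
    · simp only [Set.indicator, Set.mem_Ioi, h, if_false, zero_le]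
  · rcases eq_or_ne c 0 with rfl | h0
    · simp
    · have := hreal c.toReal (ENNReal.toReal_pos h0 hc)
      rwa [ENNReal.ofReal_toReal hc] at this

lemma measurable_seqShift {E : Type*} [MeasurableSpace E] (k : ℤ) :
    Measurable (seqShift k : (ℤ → E) → ℤ → E) :=
  measurable_pi_lambda _ fun h => measurable_pi_apply (h - k)

lemma seqShift_seqShift {E : Type*} (j k : ℤ) (x : ℤ → E) :
    seqShift j (seqShift k x) = seqShift (j + k) x := by
  funext h
  simp only [seqShift]
  congr 1
  ring

lemma seqShift_zero {E : Type*} (x : ℤ → E) : seqShift 0 x = x := by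
  funext h
  simp [seqShift]

lemma image_seqShift {E : Type*} (k : ℤ) (A : Set (ℤ → E)) :
    seqShift k '' A = seqShift (-k) ⁻¹' A :=
  congrFun (Set.image_eq_preimage_of_inverse (f := seqShift k) (g := seqShift (-k))
    (fun x => by rw [seqShift_seqShift, neg_add_cancel, seqShift_zero])
    (fun x => by rw [seqShift_seqShift, add_neg_cancel, seqShift_zero])) A

/-- Invariance under the backshift entails invariance under all its iterates. -/
lemma ShiftInvariant.measure_preimage_seqShift {E : Type*} [MeasurableSpace E]
    {ν : Measure (ℤ → E)} (hν : ShiftInvariant ν) (h : ℤ) {A : Set (ℤ → E)}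
    (hA : MeasurableSet A) : ν (seqShift h ⁻¹' A) = ν A := by
  have hstep : ∀ k : ℤ, ν (seqShift k ⁻¹' A) = ν (seqShift (k - 1) ⁻¹' A) := by
    intro k
    rw [← hν _ (measurable_seqShift k hA), image_seqShift, ← Set.preimage_comp]
    congr 2
    funext x
    rw [Function.comp_apply, seqShift_seqShift, sub_eq_add_neg]
  induction h using Int.induction_on with
  | zero =>
    congr 1
    ext x
    rw [Set.mem_preimage, seqShift_zero]
  | succ n ih => rw [hstep, add_sub_cancel_right, ih]
  | pred n ih => rw [← hstep, ih]

namespace MeasCone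

variable {E : Type*} [MeasurableSpace E] (K : MeasCone E)

lemma sSmul_seqShift (u : ℝ) (k : ℤ) (x : ℤ → E) :
    K.sSmul u (seqShift k x) = seqShift k (K.sSmul u x) := rfl

lemma sSmul_sSmul {u v : ℝ} (hu : 0 < u) (hv : 0 < v) (x : ℤ → E) :
    K.sSmul u (K.sSmul v x) = K.sSmul (u * v) x :=
  funext fun _ => K.smul_smul u v hu hv _

lemma measurable_sSmul_s3 : Measurable fun p : ℝ × (ℤ → E) => K.sSmul p.1 p.2 :=
  measurable_pi_lambda _ fun h =>
    K.measurable_smul.comp (measurable_fst.prodMk ((measurable_pi_apply h).comp measurable_snd))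

/-- The mass `∫_0^∞ 1{rx ∈ A} α r^{-α-1} dr` that the ray through `x` gives to `A`. -/
noncomputable def rayMass (α : ℝ) (A : Set (ℤ → E)) (x : ℤ → E) : ℝ≥0∞ :=
  ∫⁻ r in Set.Ioi (0 : ℝ), A.indicator 1 (K.sSmul r x) * ENNReal.ofReal (α * r ^ (-α - 1))

lemma measurable_rayMass_integrand (α : ℝ) {A : Set (ℤ → E)} (hA : MeasurableSet A) :
    Measurable fun p : ℝ × (ℤ → E) =>
      A.indicator (1 : (ℤ → E) → ℝ≥0∞) (K.sSmul p.1 p.2) *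
        ENNReal.ofReal (α * p.1 ^ (-α - 1)) :=
  ((measurable_one.indicator hA).comp K.measurable_sSmul_s3).mul (by fun_prop)

lemma measurable_rayMass (α : ℝ) {A : Set (ℤ → E)} (hA : MeasurableSet A) :
    Measurable (K.rayMass α A) :=
  (K.measurable_rayMass_integrand α hA).lintegral_prod_left'

lemma rayMass_seqShift (α : ℝ) (A : Set (ℤ → E)) (k : ℤ) (x : ℤ → E) :
    K.rayMass α A (seqShift k x) = K.rayMass α (seqShift k ⁻¹' A) x := rfl

lemma rayMass_sSmul (α : ℝ) (A : Set (ℤ → E)) {u : ℝ} (hu : 0 < u) (x : ℤ → E) :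
    K.rayMass α A (K.sSmul u x) = ENNReal.ofReal (u ^ α) * K.rayMass α A x := by
  have himage : (fun r : ℝ => r * u) '' Set.Ioi 0 = Set.Ioi 0 := by
    ext r
    refine ⟨?_, fun hr => ⟨r / u, div_pos hr hu, div_mul_cancel₀ r hu.ne'⟩⟩
    rintro ⟨s, hs, rfl⟩
    exact mul_pos hs hu
  have hsubst := lintegral_image_eq_lintegral_abs_deriv_mul (s := Set.Ioi (0 : ℝ))
    (f := fun r => r * u) (f' := fun _ => u) measurableSet_Ioi
    (fun r _ => by simpa using ((hasDerivAt_id r).mul_const u).hasDerivWithinAt)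
    (mul_left_injective₀ hu.ne').injOn
    (fun r => A.indicator 1 (K.sSmul r x) * ENNReal.ofReal (α * r ^ (-α - 1)))
  rw [himage] at hsubst
  simp only [rayMass]
  rw [hsubst, ← lintegral_const_mul' _ _ ENNReal.ofReal_ne_top]
  refine setLIntegral_congr_fun measurableSet_Ioi fun r hr => ?_
  have hr : 0 < r := hr
  have hweight : α * r ^ (-α - 1) = u ^ α * (u * (α * (r * u) ^ (-α - 1))) := by
    rw [Real.mul_rpow hr.le hu.le, Real.rpow_sub_one hu.ne', Real.rpow_neg hu.le]
    have := (Real.rpow_pos_of_pos hu α).ne'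
    field_simp
  rw [K.sSmul_sSmul hr hu, hweight, ENNReal.ofReal_mul (Real.rpow_nonneg hu.le _),
    ENNReal.ofReal_mul hu.le, abs_of_pos hu]
  ring

/-- An `α`-homogeneous function is recovered from its superlevel set at `1`. -/
lemma rayMass_one_lt {α : ℝ} (hα : 0 < α) {H : (ℤ → E) → ℝ≥0∞}
    (hH : ∀ u : ℝ, 0 < u → ∀ x, H (K.sSmul u x) = ENNReal.ofReal (u ^ α) * H x) (x : ℤ → E) :
    K.rayMass α {y | 1 < H y} x = H x := by
  rw [← lintegral_Ioi_indicator_one_lt_rpow_mul hα (H x), rayMass]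
  refine setLIntegral_congr_fun measurableSet_Ioi fun r hr => ?_
  simp only [Set.indicator, Set.mem_ofPred_eq, Set.mem_Ioi, hH r hr, Pi.one_apply]

/-- The tail measure of `Z` gives to `A` the expected mass of the ray through `Z`. -/
lemma lintegral_rayMass (α : ℝ) {Ω : Type*} [MeasurableSpace Ω] (P : Measure Ω) [SFinite P]
    {Z : Ω → ℤ → E} (hZ : Measurable Z) {A : Set (ℤ → E)} (hA : MeasurableSet A) :
    ∫⁻ ω, K.rayMass α A (Z ω) ∂P = ∫⁻ r in Set.Ioi (0 : ℝ),
      P {ω | K.sSmul r (Z ω) ∈ A} * ENNReal.ofReal (α * r ^ (-α - 1)) := by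
  simp only [rayMass]
  have hint : Measurable (Function.uncurry fun (ω : Ω) (r : ℝ) =>
      A.indicator (1 : (ℤ → E) → ℝ≥0∞) (K.sSmul r (Z ω)) * ENNReal.ofReal (α * r ^ (-α - 1))) :=
    (K.measurable_rayMass_integrand α hA).comp
      (measurable_snd.prodMk (hZ.comp measurable_fst))
  rw [lintegral_lintegral_swap hint.aemeasurable]
  refine lintegral_congr fun r => ?_
  rw [lintegral_mul_const' _ _ ENNReal.ofReal_ne_top]
  congr 1
  have hmeas : MeasurableSet {ω | K.sSmul r (Z ω) ∈ A} :=
    (K.measurable_sSmul_s3.comp (measurable_const.prodMk hZ)) hA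
  rw [← lintegral_indicator_one hmeas]
  rfl

end MeasCone

open MeasCone in
/-- the tail measure `ν(A) = ∫_0^∞ P(rZ ∈ A) α r^{-α-1} dr` is shift-invariant
if and only if `Z` satisfies the tilt-shift formula `E[H(B^h Z)] = E[H(Z)]` for every `h ∈ ℤ` and
every measurable `α`-homogeneous `H : E^ℤ → [0,∞]`. -/
theorem shiftInvariant_iff_tiltShiftFormula
    {E : Type*} [MeasurableSpace E] (K : MeasCone E) (α : ℝ) (hα : 0 < α)
    {Ω : Type*} [MeasurableSpace Ω] (P : Measure Ω) [IsProbabilityMeasure P]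
    (Z : Ω → ℤ → E) (hZmeas : Measurable Z)
    (hZzero : P {ω | Z ω = K.zeroSeq} = 0)
    (hZone : ∫⁻ ω, ENNReal.ofReal (K.nrm (Z ω 0) ^ α) ∂P = 1)
    (hZfin : ∀ h : ℤ, ∫⁻ ω, ENNReal.ofReal (K.nrm (Z ω h) ^ α) ∂P < ⊤)
    (ν : Measure (ℤ → E))
    (hν : ∀ A : Set (ℤ → E), MeasurableSet A →
      ν A = ∫⁻ r in Set.Ioi (0 : ℝ),
        P {ω | K.sSmul r (Z ω) ∈ A} * ENNReal.ofReal (α * r ^ (-α - 1)) ∂volume) :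
    ShiftInvariant ν ↔
      ∀ (h : ℤ) (H : (ℤ → E) → ℝ≥0∞), Measurable H →
        (∀ (u : ℝ), 0 < u → ∀ x, H (K.sSmul u x) = ENNReal.ofReal (u ^ α) * H x) →
        ∫⁻ ω, H (seqShift h (Z ω)) ∂P = ∫⁻ ω, H (Z ω) ∂P := by
  have hνray : ∀ A : Set (ℤ → E), MeasurableSet A → ν A = ∫⁻ ω, K.rayMass α A (Z ω) ∂P :=
    fun A hA => (hν A hA).trans (K.lintegral_rayMass α P hZmeas hA).symm
  constructor
  · intro hinv h H hH hhom
    have hA : MeasurableSet {y | 1 < H y} := measurableSet_lt measurable_const hH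
    have hshift := hinv.measure_preimage_seqShift h hA
    rw [hνray _ hA, hνray _ (measurable_seqShift h hA)] at hshift
    simpa only [← K.rayMass_seqShift, K.rayMass_one_lt hα hhom] using hshift
  · intro htsf A hA
    rw [image_seqShift, hνray _ hA, hνray _ (measurable_seqShift (-1) hA)]
    exact htsf (-1) (K.rayMass α A) (K.measurable_rayMass α hA)
      fun u hu x => K.rayMass_sSmul α A hu x
end

section
/- Let ν be a tail measure with index α > 0 admitting the stochastic representation ν(A) = ∫_0^∞ P(rZ ∈ A) α r^{−α−1} dr. Then p_h := ν({x : ‖x_h‖ > 1}) = E[‖Z_h‖^α] < ∞ for all h ∈ ℤ. If p_h > 0, then for the local tail process Y^{(h)} at lag h: (i) the random variables ‖Y^{(h)}_h‖ and Θ^{(h)} = Y^{(h)}/‖Y^{(h)}_h‖ are independent; (ii) ‖Y^{(h)}_h‖ has an α-Pareto distribution, i.e. P(‖Y^{(h)}_h‖ > u) = u^{−α} for all u ≥ 1; (iii) P(Θ^{(h)} ∈ A) = p_h^{−1} E[‖Z_h‖^α 1{Z/‖Z_h‖ ∈ A}] for every measurable A. -/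
open MeasureTheory
open scoped ENNReal

lemma lintegral_Ioi_pareto_density {α c : ℝ} (hα : 0 < α) (hc : 0 < c) :
    ∫⁻ r in Set.Ioi c, ENNReal.ofReal (α * r ^ (-α - 1)) = ENNReal.ofReal (c ^ (-α)) := by
  have hint : IntegrableOn (fun r : ℝ => α * r ^ (-α - 1)) (Set.Ioi c) :=
    (integrableOn_Ioi_rpow_of_lt (by linarith) hc).const_mul α
  rw [← ofReal_integral_eq_lintegral_ofReal hint]
  · rw [integral_const_mul, integral_Ioi_rpow_of_lt (by linarith) hc]
    congr 1
    have : -α - 1 + 1 = -α := by ring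
    rw [this]
    field_simp
  · filter_upwards [ae_restrict_mem measurableSet_Ioi] with r hr
    exact mul_nonneg hα.le (Real.rpow_nonneg (hc.trans hr).le _)

namespace MeasCone

variable {E : Type*} [MeasurableSpace E] (K : MeasCone E)

lemma measurable_nrm_apply (h : ℤ) : Measurable fun x : ℤ → E => K.nrm (x h) :=
  K.measurable_nrm.comp (measurable_pi_apply h)

lemma measurable_spectralMap (h : ℤ) : Measurable (K.spectralMap h) :=
  measurable_pi_lambda _ fun j => K.measurable_smul.comp
    ((K.measurable_nrm_apply h).inv.prodMk (measurable_pi_apply j))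

lemma spectralMap_sSmul {h : ℤ} {r : ℝ} (hr : 0 < r) {x : ℤ → E} (hx : 0 < K.nrm (x h)) :
    K.spectralMap h (K.sSmul r x) = K.spectralMap h x := by
  funext j
  simp only [spectralMap, sSmul]
  rw [K.nrm_smul r hr, K.smul_smul _ _ (by positivity) hr]
  congr 1
  field_simp

/-- Polar decomposition at lag `h` of a measure with a stochastic representation. -/
lemma measure_lt_nrm_inter_spectralMap_preimage {α : ℝ} (hα : 0 < α)
    {Ω : Type*} [MeasurableSpace Ω] (P : Measure Ω) [SFinite P]
    {Z : Ω → ℤ → E} (hZmeas : Measurable Z) {ν : Measure (ℤ → E)}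
    (hν : ∀ A : Set (ℤ → E), MeasurableSet A →
      ν A = ∫⁻ r in Set.Ioi (0 : ℝ),
        P {ω | K.sSmul r (Z ω) ∈ A} * ENNReal.ofReal (α * r ^ (-α - 1)) ∂volume)
    (h : ℤ) {u : ℝ} (hu : 0 < u) {A : Set (ℤ → E)} (hA : MeasurableSet A) :
    ν ({x | u < K.nrm (x h)} ∩ K.spectralMap h ⁻¹' A) = ENNReal.ofReal (u ^ (-α)) *
      ∫⁻ ω, ENNReal.ofReal (K.nrm (Z ω h) ^ α) *
        Set.indicator A (fun _ => (1 : ℝ≥0∞)) (K.spectralMap h (Z ω)) ∂P := by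
  have hn : Measurable fun ω => K.nrm (Z ω h) := (K.measurable_nrm_apply h).comp hZmeas
  have hs : Measurable fun ω => K.spectralMap h (Z ω) := (K.measurable_spectralMap h).comp hZmeas
  have hind : Measurable fun ω =>
      Set.indicator A (fun _ => (1 : ℝ≥0∞)) (K.spectralMap h (Z ω)) :=
    (measurable_const.indicator hA).comp hs
  have hw : Measurable fun r : ℝ => ENNReal.ofReal (α * r ^ (-α - 1)) := by fun_prop
  have hT : MeasurableSet {p : ℝ × Ω | u < p.1 * K.nrm (Z p.2 h)} :=
    measurableSet_lt measurable_const (measurable_fst.mul (hn.comp measurable_snd))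
  have key : ∀ r ∈ Set.Ioi (0 : ℝ), {ω | K.sSmul r (Z ω) ∈
      {x | u < K.nrm (x h)} ∩ K.spectralMap h ⁻¹' A} =
      {ω | u < r * K.nrm (Z ω h)} ∩ {ω | K.spectralMap h (Z ω) ∈ A} := by
    intro r hr
    ext ω
    have hnr : K.nrm (K.sSmul r (Z ω) h) = r * K.nrm (Z ω h) := K.nrm_smul r hr _
    simp only [Set.mem_ofPred_eq, Set.mem_inter_iff, Set.mem_preimage, hnr]
    refine and_congr_right fun hlt => ?_
    rw [K.spectralMap_sSmul hr (pos_of_mul_pos_right (hu.trans hlt) hr.le)]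
  rw [hν _ ((measurableSet_lt measurable_const (K.measurable_nrm_apply h)).inter
    (K.measurable_spectralMap h hA))]
  calc
    _ = ∫⁻ r in Set.Ioi (0 : ℝ), ∫⁻ ω,
          Set.indicator {p : ℝ × Ω | u < p.1 * K.nrm (Z p.2 h)} (fun _ => (1 : ℝ≥0∞)) (r, ω) *
          Set.indicator A (fun _ => (1 : ℝ≥0∞)) (K.spectralMap h (Z ω)) *
          ENNReal.ofReal (α * r ^ (-α - 1)) ∂P := by
      refine setLIntegral_congr_fun measurableSet_Ioi fun r hr => ?_
      have hm : MeasurableSet ({ω | u < r * K.nrm (Z ω h)} ∩ {ω | K.spectralMap h (Z ω) ∈ A}) :=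
        (measurableSet_lt measurable_const (hn.const_mul r)).inter (hs hA)
      rw [key r hr, ← lintegral_indicator_one hm,
        ← lintegral_mul_const _ (measurable_one.indicator hm)]
      refine lintegral_congr fun ω => ?_
      by_cases h1 : u < r * K.nrm (Z ω h) <;> by_cases h2 : K.spectralMap h (Z ω) ∈ A <;>
        simp [Set.indicator, h1, h2]
    _ = ∫⁻ ω, (∫⁻ r in Set.Ioi (0 : ℝ),
          Set.indicator {p : ℝ × Ω | u < p.1 * K.nrm (Z p.2 h)} (fun _ => (1 : ℝ≥0∞)) (r, ω) *
          Set.indicator A (fun _ => (1 : ℝ≥0∞)) (K.spectralMap h (Z ω)) *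
          ENNReal.ofReal (α * r ^ (-α - 1))) ∂P := by
      refine lintegral_lintegral_swap (Measurable.aemeasurable ?_)
      exact ((measurable_const.indicator hT).mul (hind.comp measurable_snd)).mul
        (hw.comp measurable_fst)
    _ = ∫⁻ ω, ENNReal.ofReal (u ^ (-α)) * (ENNReal.ofReal (K.nrm (Z ω h) ^ α) *
          Set.indicator A (fun _ => (1 : ℝ≥0∞)) (K.spectralMap h (Z ω))) ∂P := by
      refine lintegral_congr fun ω => ?_
      rcases (K.nrm_nonneg (Z ω h)).eq_or_lt with h0 | h0
      · simp [Set.indicator, ← h0, hu.not_gt, Real.zero_rpow hα.ne']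
      have hc : 0 < u / K.nrm (Z ω h) := div_pos hu h0
      have e : ∀ r : ℝ,
          Set.indicator {p : ℝ × Ω | u < p.1 * K.nrm (Z p.2 h)} (fun _ => (1 : ℝ≥0∞)) (r, ω) *
          Set.indicator A (fun _ => (1 : ℝ≥0∞)) (K.spectralMap h (Z ω)) *
          ENNReal.ofReal (α * r ^ (-α - 1)) =
          Set.indicator A (fun _ => (1 : ℝ≥0∞)) (K.spectralMap h (Z ω)) *
          (Set.Ioi (u / K.nrm (Z ω h))).indicator
            (fun r => ENNReal.ofReal (α * r ^ (-α - 1))) r := by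
        intro r
        simp only [Set.indicator, Set.mem_ofPred_eq, Set.mem_Ioi, div_lt_iff₀ h0]
        split_ifs <;> simp
      simp_rw [e]
      rw [lintegral_const_mul _ (hw.indicator measurableSet_Ioi),
        setLIntegral_indicator measurableSet_Ioi,
        Set.inter_eq_left.2 (Set.Ioi_subset_Ioi hc.le), lintegral_Ioi_pareto_density hα hc,
        Real.div_rpow hu.le h0.le, Real.rpow_neg h0.le, div_inv_eq_mul,
        ENNReal.ofReal_mul (Real.rpow_nonneg hu.le _)]
      ring
    _ = _ := lintegral_const_mul _ ((hn.pow_const α).ennreal_ofReal.mul hind)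

end MeasCone

open MeasCone in
/-- for a tail measure with stochastic representation given by `Z`,
`p_h = ν({x : ‖x_h‖ > 1}) = E[‖Z_h‖^α] < ∞`; and if `p_h > 0` then, for the local tail
process `Y^{(h)}` at lag `h` (whose law is `p_h⁻¹ ν restricted to {‖x_h‖>1}`):
`‖Y^{(h)}_h‖` and `Θ^{(h)} = Y^{(h)}/‖Y^{(h)}_h‖` are independent, `‖Y^{(h)}_h‖` is
`α`-Pareto, and `P(Θ^{(h)} ∈ A) = p_h⁻¹ E[‖Z_h‖^α 1_{Z/‖Z_h‖ ∈ A}]`. -/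
theorem localTailProcess_properties
    {E : Type*} [MeasurableSpace E] (K : MeasCone E) (α : ℝ) (hα : 0 < α)
    {Ω : Type*} [MeasurableSpace Ω] (P : Measure Ω) [IsProbabilityMeasure P]
    (Z : Ω → ℤ → E) (hZmeas : Measurable Z)
    (hZzero : P {ω | Z ω = K.zeroSeq} = 0)
    (hZone : ∫⁻ ω, ENNReal.ofReal (K.nrm (Z ω 0) ^ α) ∂P = 1)
    (hZfin : ∀ h : ℤ, ∫⁻ ω, ENNReal.ofReal (K.nrm (Z ω h) ^ α) ∂P < ⊤)
    (ν : Measure (ℤ → E)) (hνtail : K.IsTailMeasure α ν)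
    (hν : ∀ A : Set (ℤ → E), MeasurableSet A →
      ν A = ∫⁻ r in Set.Ioi (0 : ℝ),
        P {ω | K.sSmul r (Z ω) ∈ A} * ENNReal.ofReal (α * r ^ (-α - 1)) ∂volume) :
    (∀ h : ℤ, ν {x | 1 < K.nrm (x h)} = ∫⁻ ω, ENNReal.ofReal (K.nrm (Z ω h) ^ α) ∂P ∧
        ν {x | 1 < K.nrm (x h)} < ⊤) ∧
    ∀ h : ℤ, 0 < ν {x | 1 < K.nrm (x h)} →
      (Measure.map (fun x => (K.nrm (x h), K.spectralMap h x))
            ((ν {x | 1 < K.nrm (x h)})⁻¹ • ν.restrict {x | 1 < K.nrm (x h)})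
          = (Measure.map (fun x => K.nrm (x h))
                ((ν {x | 1 < K.nrm (x h)})⁻¹ • ν.restrict {x | 1 < K.nrm (x h)})).prod
              (Measure.map (K.spectralMap h)
                ((ν {x | 1 < K.nrm (x h)})⁻¹ • ν.restrict {x | 1 < K.nrm (x h)}))) ∧
      (∀ u : ℝ, 1 ≤ u →
        ((ν {x | 1 < K.nrm (x h)})⁻¹ • ν.restrict {x | 1 < K.nrm (x h)})
            {x | u < K.nrm (x h)} = ENNReal.ofReal (u ^ (-α))) ∧
      (∀ A : Set (ℤ → E), MeasurableSet A →
        ((ν {x | 1 < K.nrm (x h)})⁻¹ • ν.restrict {x | 1 < K.nrm (x h)})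
            {x | K.spectralMap h x ∈ A}
          = (ν {x | 1 < K.nrm (x h)})⁻¹ *
              ∫⁻ ω, ENNReal.ofReal (K.nrm (Z ω h) ^ α) *
                Set.indicator A (fun _ => (1 : ℝ≥0∞)) (K.spectralMap h (Z ω)) ∂P) := by
  set I : Set (ℤ → E) → ℤ → ℝ≥0∞ := fun A h => ∫⁻ ω, ENNReal.ofReal (K.nrm (Z ω h) ^ α) *
    Set.indicator A (fun _ => (1 : ℝ≥0∞)) (K.spectralMap h (Z ω)) ∂P with hI
  have polar : ∀ (h : ℤ) (u : ℝ), 0 < u → ∀ A : Set (ℤ → E), MeasurableSet A →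
      ν ({x | u < K.nrm (x h)} ∩ K.spectralMap h ⁻¹' A) = ENNReal.ofReal (u ^ (-α)) * I A h :=
    fun h u hu A hA => K.measure_lt_nrm_inter_spectralMap_preimage hα P hZmeas hν h hu hA
  have hp : ∀ h : ℤ, ν {x | 1 < K.nrm (x h)} = I Set.univ h := fun h => by
    simpa using polar h 1 one_pos Set.univ MeasurableSet.univ
  refine ⟨fun h => ⟨by simpa [hI] using hp h, hνtail.2.2.1 h⟩, fun h hpos => ?_⟩
  have hfin : ν {x | 1 < K.nrm (x h)} ≠ ⊤ := (hνtail.2.2.1 h).ne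
  have hn : Measurable fun x : ℤ → E => K.nrm (x h) := K.measurable_nrm_apply h
  have hs : Measurable (K.spectralMap h) := K.measurable_spectralMap h
  set p := ν {x | 1 < K.nrm (x h)} with hp_def
  set μ : Measure (ℤ → E) := p⁻¹ • ν.restrict {x | 1 < K.nrm (x h)} with hμ
  have hinv : p⁻¹ * p = 1 := ENNReal.inv_mul_cancel hpos.ne' hfin
  have : IsProbabilityMeasure μ := ⟨by simp [hμ, ← hp_def, hinv]⟩
  have joint : ∀ (u : ℝ) (A : Set (ℤ → E)), MeasurableSet A →
      μ ({x | u < K.nrm (x h)} ∩ K.spectralMap h ⁻¹' A) =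
        ENNReal.ofReal (max u 1 ^ (-α)) * (p⁻¹ * I A h) := by
    intro u A hA
    have hset : {x : ℤ → E | u < K.nrm (x h)} ∩ K.spectralMap h ⁻¹' A ∩ {x | 1 < K.nrm (x h)} =
        {x | max u 1 < K.nrm (x h)} ∩ K.spectralMap h ⁻¹' A := by
      ext x
      simp only [Set.mem_inter_iff, Set.mem_ofPred_eq, max_lt_iff]
      tauto
    rw [hμ, Measure.smul_apply, Measure.restrict_apply
      ((measurableSet_lt measurable_const hn).inter (hs hA)), hset,
      polar h _ (lt_max_of_lt_right one_pos) A hA, smul_eq_mul]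
    ring
  have pareto : ∀ u : ℝ, μ {x | u < K.nrm (x h)} = ENNReal.ofReal (max u 1 ^ (-α)) := by
    intro u
    simpa [← hp h, ← hp_def, hinv] using joint u Set.univ MeasurableSet.univ
  have spectral : ∀ A : Set (ℤ → E), MeasurableSet A →
      μ (K.spectralMap h ⁻¹' A) = p⁻¹ * I A h := by
    intro A hA
    have h0 : {x : ℤ → E | -1 < K.nrm (x h)} = Set.univ :=
      Set.eq_univ_of_forall fun x => neg_one_lt_zero.trans_le (K.nrm_nonneg _)
    simpa [h0] using joint (-1) A hA
  clear_value μ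
  refine ⟨?_, fun u hu => by rw [pareto, max_eq_left hu], spectral⟩
  have := Measure.isProbabilityMeasure_map (μ := μ) hn.aemeasurable
  have := Measure.isProbabilityMeasure_map (μ := μ) hs.aemeasurable
  refine (Measure.prod_eq fun B A hB hA => ?_).symm
  have hmarg : (μ.restrict (K.spectralMap h ⁻¹' A)).map (fun x => K.nrm (x h)) =
      μ (K.spectralMap h ⁻¹' A) • μ.map fun x => K.nrm (x h) := by
    have := Measure.isFiniteMeasure_map (μ.restrict (K.spectralMap h ⁻¹' A))
      fun x => K.nrm (x h)
    refine ext_of_generate_finite _ (BorelSpace.measurable_eq.trans (borel_eq_generateFrom_Ioi ℝ))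
      isPiSystem_Ioi ?_ (by simp [Measure.map_apply hn])
    rintro _ ⟨u, rfl⟩
    rw [Measure.map_apply hn measurableSet_Ioi, Measure.restrict_apply (hn measurableSet_Ioi),
      Measure.smul_apply, Measure.map_apply hn measurableSet_Ioi, smul_eq_mul, spectral A hA]
    change μ ({x | u < K.nrm (x h)} ∩ _) = _ * μ {x | u < K.nrm (x h)}
    rw [joint u A hA, pareto, mul_comm]
  have hB' := congrArg (fun m : Measure ℝ => m B) hmarg
  simp only [Measure.map_apply hn hB, Measure.restrict_apply (hn hB), Measure.smul_apply,
    smul_eq_mul] at hB'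
  rw [Measure.map_apply (hn.prodMk hs) (hB.prod hA), Measure.map_apply hn hB,
    Measure.map_apply hs hA, mul_comm]
  exact hB'
end
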